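/- arXiv:2310.05898 — 3 statements merged into one kernel-verified Lean document; each statement's English description precedes it below -/
import Mathlib

section
/- Consider the ODE without gradient enhancement (ε = 0): ẋ_t = ∇φ(m_t) − λ x_t, ṁ_t = −α∇f(x_t) − γ m_t, with λ, α, γ > 0 and φ, φ* differentiable convex conjugates. Define H(x,m) = α f(x) + (γ/λ) φ*(λx) + ( φ*(λx) + φ(m) − λ xᵀm ). Then along any solution, (d/dt) H(x_t, m_t) = −(γ + λ)(m_t − ∇φ*(λ x_t))ᵀ(∇φ(m_t) − λ x_t) ≤ 0, so H is a Lyapunov function. Moreover, this ODE is a Hamiltonian-plus-descent system: (ẋ, ṁ) = (∇_m H, −∇_x H) − (0, (γ+λ)(m − ∇φ*(λx))), and its fixed points are the stationary points of min_x α f(x) + (γ/λ) φ*(λx). -/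
open scoped RealInnerProductSpace

/-- The convex (Fenchel) conjugate `φ*(y) = sup_z (yᵀz − φ(z))`,
valued in the extended reals. -/
noncomputable def fenchelConj {d : ℕ} (φ : EuclideanSpace ℝ (Fin d) → ℝ)
    (y : EuclideanSpace ℝ (Fin d)) : EReal :=
  ⨆ z : EuclideanSpace ℝ (Fin d), ((⟪y, z⟫ - φ z : ℝ) : EReal)

section GradientLemmas

variable {E : Type*} [NormedAddCommGroup E] [InnerProductSpace ℝ E] [CompleteSpace E]

theorem HasFDerivAt.hasGradientAt_of_forall_apply_eq {g : E → ℝ} {L : E →L[ℝ] ℝ} {g' x : E}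
    (h : HasFDerivAt g L x) (hL : ∀ v, L v = ⟪g', v⟫) : HasGradientAt g g' x := by
  obtain rfl : L = innerSL ℝ g' := ContinuousLinearMap.ext hL
  exact h

theorem HasGradientAt.comp_hasDerivAt_inner {g : E → ℝ} {g' : E} {u : ℝ → E} {u' : E} {t : ℝ}
    (hg : HasGradientAt g g' (u t)) (hu : HasDerivAt u u' t) :
    HasDerivAt (fun τ => g (u τ)) ⟪g', u'⟫ t := by
  exact HasFDerivAt.comp_hasDerivAt (l := g) (l' := innerSL ℝ g') t hg.hasFDerivAt hu

theorem HasGradientAt.comp_const_smul {g : E → ℝ} {g' x : E} {c : ℝ}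
    (hg : HasGradientAt g g' (c • x)) :
    HasGradientAt (fun x' => g (c • x')) (c • g') x := by
  have hg' : HasFDerivAt g (innerSL ℝ g') (c • x) := hg
  have h : HasFDerivAt (fun x' => g (c • x')) _ x :=
    hg'.comp x ((hasFDerivAt_id (𝕜 := ℝ) x).const_smul c)
  exact h.hasGradientAt_of_forall_apply_eq fun v => by
    simp [inner_smul_left]

theorem ConvexOn.add_inner_gradient_le {g : E → ℝ} {g' z : E} (hg : ConvexOn ℝ Set.univ g)
    (hz : HasGradientAt g g' z) (w : E) : g z + ⟪g', w - z⟫ ≤ g w := by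
  have hline : ConvexOn ℝ Set.univ (g ∘ AffineMap.lineMap (k := ℝ) z w) := by
    simpa using hg.comp_affineMap (AffineMap.lineMap (k := ℝ) z w)
  have hderiv : HasDerivAt (g ∘ AffineMap.lineMap (k := ℝ) z w) ⟪g', w - z⟫ 0 :=
    HasGradientAt.comp_hasDerivAt_inner (by simpa using hz) AffineMap.hasDerivAt_lineMap
  have h := hline.le_slope_of_hasDerivAt (Set.mem_univ 0) (Set.mem_univ 1) one_pos hderiv
  simp [slope_def_field] at h
  linarith

theorem ConvexOn.inner_gradient_sub_nonneg {g : E → ℝ} {g' : E → E}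
    (hg : ConvexOn ℝ Set.univ g) (hg' : ∀ z, HasGradientAt g (g' z) z) (z w : E) :
    0 ≤ ⟪z - w, g' z - g' w⟫ := by
  have h₁ := hg.add_inner_gradient_le (hg' z) w
  have h₂ := hg.add_inner_gradient_le (hg' w) z
  rw [real_inner_comm, inner_sub_left]
  rw [← neg_sub z w, inner_neg_right] at h₁
  linarith

theorem HasGradientAt.eq_of_forall_sub_inner_le {g : E → ℝ} {g' y z : E}
    (hz : HasGradientAt g g' z) (hmin : ∀ w, g z - ⟪y, z⟫ ≤ g w - ⟪y, w⟫) : g' = y := by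
  have hd : HasFDerivAt (fun w => g w - ⟪y, w⟫)
      (InnerProductSpace.toDual ℝ E g' - innerSL ℝ y) z :=
    hz.hasFDerivAt.sub (innerSL ℝ y).hasFDerivAt
  have h := IsLocalMin.hasFDerivAt_eq_zero (Filter.Eventually.of_forall hmin) hd
  refine ext_inner_right ℝ fun v => ?_
  have hv := DFunLike.congr_fun h v
  simp at hv
  linarith

end GradientLemmas

section FenchelConjugate

variable {d : ℕ} {φ φs : EuclideanSpace ℝ (Fin d) → ℝ}
  {φ' φs' : EuclideanSpace ℝ (Fin d) → EuclideanSpace ℝ (Fin d)}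

theorem inner_sub_le_of_fenchelConj_eq (hφs : ∀ y, fenchelConj φ y = ((φs y : ℝ) : EReal))
    (y z : EuclideanSpace ℝ (Fin d)) : ⟪y, z⟫ - φ z ≤ φs y := by
  rw [← EReal.coe_le_coe_iff, ← hφs]
  exact le_iSup (fun z : EuclideanSpace ℝ (Fin d) => ((⟪y, z⟫ - φ z : ℝ) : EReal)) z

theorem fenchelConj_gradient_le (hconv : ConvexOn ℝ Set.univ φ)
    (hφ' : ∀ z, HasGradientAt φ (φ' z) z)
    (hφs : ∀ y, fenchelConj φ y = ((φs y : ℝ) : EReal)) (z : EuclideanSpace ℝ (Fin d)) :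
    φs (φ' z) ≤ ⟪φ' z, z⟫ - φ z := by
  rw [← EReal.coe_le_coe_iff, ← hφs]
  refine iSup_le fun w => EReal.coe_le_coe_iff.mpr ?_
  have h := hconv.add_inner_gradient_le (hφ' z) w
  rw [inner_sub_right] at h
  linarith

theorem gradient_conj_gradient (hconv : ConvexOn ℝ Set.univ φ)
    (hφ' : ∀ z, HasGradientAt φ (φ' z) z)
    (hφs : ∀ y, fenchelConj φ y = ((φs y : ℝ) : EReal))
    (hφs' : ∀ y, HasGradientAt φs (φs' y) y) (z : EuclideanSpace ℝ (Fin d)) :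
    φs' (φ' z) = z := by
  refine (hφs' _).eq_of_forall_sub_inner_le fun y => ?_
  have h₁ := fenchelConj_gradient_le hconv hφ' hφs z
  have h₂ := inner_sub_le_of_fenchelConj_eq hφs y z
  rw [real_inner_comm _ z, real_inner_comm _ z]
  linarith

/-- Finiteness and continuity of the conjugate make `φ - ⟪y, ·⟫` coercive. -/
theorem exists_forall_sub_inner_le (hφ : Continuous φ) (hφsc : Continuous φs)
    (hφs : ∀ y, fenchelConj φ y = ((φs y : ℝ) : EReal)) (y : EuclideanSpace ℝ (Fin d)) :
    ∃ z, ∀ w, φ z - ⟪y, z⟫ ≤ φ w - ⟪y, w⟫ := by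
  obtain ⟨C, hC⟩ := (isCompact_closedBall y 1).bddAbove_image hφsc.continuousOn
  have hbound : ∀ w, ‖w‖ - C ≤ φ w - ⟪y, w⟫ := by
    intro w
    have hmem : y + ‖w‖⁻¹ • w ∈ Metric.closedBall y 1 := by
      rw [mem_closedBall_iff_norm, add_sub_cancel_left, norm_smul, norm_inv, norm_norm]
      exact inv_mul_le_one
    have h₁ := hC (Set.mem_image_of_mem φs hmem)
    have h₂ := inner_sub_le_of_fenchelConj_eq hφs (y + ‖w‖⁻¹ • w) w
    have h₃ : ‖w‖⁻¹ * (‖w‖ * ‖w‖) = ‖w‖ := by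
      rcases eq_or_ne ‖w‖ 0 with h | h
      · simp [h]
      · field_simp
    rw [inner_add_left, real_inner_smul_left, real_inner_self_eq_norm_mul_norm, h₃] at h₂
    linarith
  refine Continuous.exists_forall_le (f := fun w => φ w - ⟪y, w⟫) (by fun_prop) ?_
  refine Filter.tendsto_atTop_mono hbound ?_
  exact Filter.tendsto_atTop_add_const_right _ (-C) (tendsto_norm_cocompact_atTop)

theorem gradient_gradient_conj (hconv : ConvexOn ℝ Set.univ φ)
    (hφ' : ∀ z, HasGradientAt φ (φ' z) z)
    (hφs : ∀ y, fenchelConj φ y = ((φs y : ℝ) : EReal))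
    (hφs' : ∀ y, HasGradientAt φs (φs' y) y) (y : EuclideanSpace ℝ (Fin d)) :
    φ' (φs' y) = y := by
  obtain ⟨z, hz⟩ := exists_forall_sub_inner_le
    (continuous_iff_continuousAt.mpr fun z => (hφ' z).continuousAt)
    (continuous_iff_continuousAt.mpr fun y => (hφs' y).continuousAt) hφs y
  have hzy : φ' z = y := (hφ' z).eq_of_forall_sub_inner_le hz
  rw [← hzy, gradient_conj_gradient hconv hφ' hφs hφs']

end FenchelConjugate

/-- Lion-φ without gradient enhancement, `ε = 0`: for the ODE
`ẋ = ∇φ(m) − λx`, `ṁ = −α∇f(x) − γm` with `λ, α, γ > 0`, the function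
`H(x,m) = α f(x) + (γ/λ)φ*(λx) + (φ*(λx) + φ(m) − λ xᵀm)` satisfies
`(d/dt)H(x_t,m_t) = −(γ+λ)(m_t − ∇φ*(λx_t))ᵀ(∇φ(m_t) − λx_t) ≤ 0` along solutions,
the ODE is a Hamiltonian-plus-descent system
`(ẋ, ṁ) = (∇ₘH, −∇ₓH) − (0, (γ+λ)(m − ∇φ*(λx)))`, and its fixed points are exactly
the stationary points of `x ↦ α f(x) + (γ/λ) φ*(λx)`. -/
theorem lion_no_gradient_enhancement {d : ℕ}
    (φ f : EuclideanSpace ℝ (Fin d) → ℝ)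
    (φ' f' : EuclideanSpace ℝ (Fin d) → EuclideanSpace ℝ (Fin d))
    (φs : EuclideanSpace ℝ (Fin d) → ℝ)
    (φs' : EuclideanSpace ℝ (Fin d) → EuclideanSpace ℝ (Fin d))
    (hconv : ConvexOn ℝ Set.univ φ)
    (hφ' : ∀ z, HasGradientAt φ (φ' z) z)
    (hf' : ∀ z, HasGradientAt f (f' z) z) (hf'c : Continuous f')
    (hφs : ∀ y, fenchelConj φ y = ((φs y : ℝ) : EReal))
    (hφs' : ∀ y, HasGradientAt φs (φs' y) y)
    (α γ lam : ℝ) (hα : 0 < α) (hγ : 0 < γ) (hlam : 0 < lam) :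
    (∀ x m : ℝ → EuclideanSpace ℝ (Fin d),
        (∀ t, HasDerivAt x (φ' (m t) - lam • x t) t) →
        (∀ t, HasDerivAt m (-(α • f' (x t)) - γ • m t) t) →
        ∀ t : ℝ,
          HasDerivAt
            (fun τ => α * f (x τ) + (γ / lam) * φs (lam • x τ)
                + (φs (lam • x τ) + φ (m τ) - lam * ⟪x τ, m τ⟫))
            (-((γ + lam) * ⟪m t - φs' (lam • x t), φ' (m t) - lam • x t⟫)) t
          ∧ -((γ + lam) * ⟪m t - φs' (lam • x t), φ' (m t) - lam • x t⟫) ≤ 0)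
    ∧ (∀ x m : EuclideanSpace ℝ (Fin d),
        HasGradientAt
          (fun m' => α * f x + (γ / lam) * φs (lam • x)
              + (φs (lam • x) + φ m' - lam * ⟪x, m'⟫))
          (φ' m - lam • x) m
        ∧ HasGradientAt
            (fun x' => α * f x' + (γ / lam) * φs (lam • x')
                + (φs (lam • x') + φ m - lam * ⟪x', m⟫))
            (α • f' x + (γ + lam) • φs' (lam • x) - lam • m) x
        ∧ -(α • f' x) - γ • m
            = -(α • f' x + (γ + lam) • φs' (lam • x) - lam • m)
              - (γ + lam) • (m - φs' (lam • x)))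
    ∧ (∀ x : EuclideanSpace ℝ (Fin d),
        (∃ m : EuclideanSpace ℝ (Fin d),
            φ' m - lam • x = 0 ∧ -(α • f' x) - γ • m = 0)
        ↔ α • f' x + γ • φs' (lam • x) = 0) := by
  have hinv := gradient_gradient_conj hconv hφ' hφs hφs'
  refine ⟨fun x m hx hm t => ⟨?_, ?_⟩, fun x m => ⟨?_, ?_, ?_⟩, fun x => ⟨?_, fun h => ?_⟩⟩
  · have hs := (hφs' (lam • x t)).comp_hasDerivAt_inner (u := fun τ => lam • x τ)
      ((hx t).const_smul lam)
    have hF := (hf' (x t)).comp_hasDerivAt_inner (hx t)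
    have hP := (hφ' (m t)).comp_hasDerivAt_inner (hm t)
    have hI := (hx t).inner ℝ (hm t)
    refine (((hF.const_mul α).add (hs.const_mul (γ / lam))).add
      ((hs.add hP).sub (hI.const_mul lam))).congr_deriv ?_
    simp only [inner_sub_left, inner_sub_right, inner_neg_right, real_inner_smul_left,
      real_inner_smul_right]
    rw [real_inner_comm (φ' (m t)) (f' (x t)), real_inner_comm (φ' (m t)) (m t),
      real_inner_comm (x t) (f' (x t)), real_inner_comm (x t) (m t)]
    field_simp
    ring
  · have h := hconv.inner_gradient_sub_nonneg hφ' (m t) (φs' (lam • x t))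
    rw [hinv] at h
    exact neg_nonpos.mpr (mul_nonneg (by positivity) h)
  · have hP : HasFDerivAt φ (innerSL ℝ (φ' m)) m := hφ' m
    have h := ((hP.const_add (φs (lam • x))).sub
      ((innerSL ℝ x).hasFDerivAt.const_mul lam)).const_add
        (α * f x + (γ / lam) * φs (lam • x))
    refine h.hasGradientAt_of_forall_apply_eq fun v => ?_
    simp [inner_sub_left, real_inner_smul_left]
  · have hs : HasFDerivAt (fun x' => φs (lam • x')) (innerSL ℝ (lam • φs' (lam • x))) x :=
      (hφs' (lam • x)).comp_const_smul
    have hF : HasFDerivAt f (innerSL ℝ (f' x)) x := hf' x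
    have h : HasFDerivAt (fun x' => α * f x' + (γ / lam) * φs (lam • x')
        + (φs (lam • x') + φ m - lam * ⟪m, x'⟫)) _ x :=
      ((hF.const_mul α).add (hs.const_mul (γ / lam))).add
        ((hs.add_const (φ m)).sub ((innerSL ℝ m).hasFDerivAt.const_mul lam))
    simp only [real_inner_comm m]
    refine h.hasGradientAt_of_forall_apply_eq fun v => ?_
    simp [inner_sub_left, inner_add_left, real_inner_smul_left]
    field_simp
    ring
  · module
  · rintro ⟨m, hm, hfm⟩
    rw [← sub_eq_zero.mp hm, gradient_conj_gradient hconv hφ' hφs hφs', ← neg_eq_zero, ← hfm]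
    module
  · refine ⟨φs' (lam • x), by rw [hinv, sub_self], ?_⟩
    rw [← neg_eq_zero, ← h]
    module
end

section
/- Consider the Lion-φ ODE with λ = 0: ẋ_t = ∇φ(m̃_t) with m̃_t = m_t − ε(α∇f(x_t) + γ m_t), ṁ_t = −α∇f(x_t) − γ m_t, with α, γ, ε > 0 and εγ < 1. Suppose m = 0 is a minimum of the convex differentiable function φ. Define the second Lyapunov function H̃(x,m) = α f(x) + (1/(1−εγ)) φ((1−εγ) m) and let m̃_t⁰ = (1−εγ) m_t (so m̃_t⁰ − m̃_t = εα∇f(x_t)). Then the ODE decomposes as (ẋ, ṁ) = (∇_m H̃, −∇_x H̃) − ( ∇φ(m̃_t⁰) − ∇φ(m̃_t), γ m_t ), and along any solution −(d/dt) H̃(x_t, m_t) = γ ∇φ(m̃_t⁰)ᵀ m_t + (1/ε)(m̃_t⁰ − m̃_t)ᵀ(∇φ(m̃_t⁰) − ∇φ(m̃_t)) ≥ 0. -/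
open scoped RealInnerProductSpace

/-- First-order characterization of convexity: a convex function lies above its tangent planes. -/
theorem ConvexOn.add_inner_gradient_le_s8 {E : Type*} [NormedAddCommGroup E]
    [InnerProductSpace ℝ E] [CompleteSpace E] {φ : E → ℝ} {g x : E}
    (hconv : ConvexOn ℝ Set.univ φ) (hg : HasGradientAt φ g x) (y : E) :
    φ x + ⟪g, y - x⟫ ≤ φ y := by
  have hc : ConvexOn ℝ Set.univ (φ ∘ AffineMap.lineMap (k := ℝ) x y) := by
    simpa using hconv.comp_affineMap (AffineMap.lineMap (k := ℝ) x y)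
  have hd : HasDerivAt (φ ∘ AffineMap.lineMap (k := ℝ) x y) ⟪g, y - x⟫ 0 := by
    have hl : HasDerivAt (AffineMap.lineMap (k := ℝ) x y) (y - x) (0 : ℝ) :=
      AffineMap.hasDerivAt_lineMap
    have hg' := hg.hasFDerivAt
    rw [← AffineMap.lineMap_apply_zero (k := ℝ) x y] at hg'
    simpa using hg'.comp_hasDerivAt (0 : ℝ) hl
  have hs := hc.le_slope_of_hasDerivAt (Set.mem_univ 0) (Set.mem_univ 1) one_pos hd
  simp [slope_def_field] at hs
  linarith

/-- The gradient of a convex function is monotone. -/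
theorem ConvexOn.inner_sub_gradient_nonneg {E : Type*} [NormedAddCommGroup E]
    [InnerProductSpace ℝ E] [CompleteSpace E] {φ : E → ℝ} {g h x y : E}
    (hconv : ConvexOn ℝ Set.univ φ) (hg : HasGradientAt φ g x) (hh : HasGradientAt φ h y) :
    0 ≤ ⟪x - y, g - h⟫ := by
  have h₁ := hconv.add_inner_gradient_le_s8 hg y
  have h₂ := hconv.add_inner_gradient_le_s8 hh x
  rw [real_inner_comm]
  simp only [inner_sub_left, inner_sub_right] at h₁ h₂ ⊢
  linarith

/-- A convex function minimized at `0` satisfies `0 ≤ ⟪∇φ z, z⟫`. -/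
theorem ConvexOn.inner_gradient_self_nonneg {E : Type*} [NormedAddCommGroup E]
    [InnerProductSpace ℝ E] [CompleteSpace E] {φ : E → ℝ} {g z : E}
    (hconv : ConvexOn ℝ Set.univ φ) (hg : HasGradientAt φ g z) (hmin : φ 0 ≤ φ z) :
    0 ≤ ⟪g, z⟫ := by
  have h := hconv.add_inner_gradient_le_s8 hg 0
  rw [zero_sub, inner_neg_right] at h
  linarith

/-- Chain rule for a gradient along a differentiable curve. -/
theorem HasGradientAt.comp_hasDerivAt_curve {E : Type*} [NormedAddCommGroup E]
    [InnerProductSpace ℝ E] [CompleteSpace E] {φ : E → ℝ} {g v : E} {u : ℝ → E} {t : ℝ}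
    (hg : HasGradientAt φ g (u t)) (hu : HasDerivAt u v t) :
    HasDerivAt (fun τ => φ (u τ)) ⟪g, v⟫ t := by
  simpa using! hg.hasFDerivAt.comp_hasDerivAt t hu

/-- second Lyapunov function for Lion-φ with `λ = 0`: for the ODE
`ẋ = ∇φ(m̃)`, `ṁ = −α∇f(x) − γm`, `m̃ = m − ε(α∇f(x) + γm)`, with `α, γ, ε > 0`,
`εγ < 1`, and `0` a minimum of `φ`, the function
`H̃(x,m) = α f(x) + (1/(1−εγ)) φ((1−εγ)m)` gives a Hamiltonian-plus-descent
decomposition `(ẋ, ṁ) = (∇ₘH̃, −∇ₓH̃) − (∇φ(m̃⁰) − ∇φ(m̃), γm)` with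
`m̃⁰ = (1−εγ)m`, and along any solution
`−(d/dt) H̃(x_t,m_t) = γ ∇φ(m̃⁰_t)ᵀm_t
  + (1/ε)(m̃⁰_t − m̃_t)ᵀ(∇φ(m̃⁰_t) − ∇φ(m̃_t)) ≥ 0`. -/
theorem lion_second_lyapunov_no_weight_decay {d : ℕ}
    (φ f : EuclideanSpace ℝ (Fin d) → ℝ)
    (φ' f' : EuclideanSpace ℝ (Fin d) → EuclideanSpace ℝ (Fin d))
    (hconv : ConvexOn ℝ Set.univ φ)
    (hφ' : ∀ z, HasGradientAt φ (φ' z) z)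
    (hf' : ∀ z, HasGradientAt f (f' z) z) (hf'c : Continuous f')
    (hmin : ∀ z, φ 0 ≤ φ z)
    (α γ ε : ℝ) (hα : 0 < α) (hγ : 0 < γ) (hε : 0 < ε) (hεγ : ε * γ < 1) :
    (∀ x m : EuclideanSpace ℝ (Fin d),
        ∃ Gx Gm : EuclideanSpace ℝ (Fin d),
          HasGradientAt
            (fun x' => α * f x' + (1 / (1 - ε * γ)) * φ ((1 - ε * γ) • m)) Gx x
          ∧ HasGradientAt
              (fun m' => α * f x + (1 / (1 - ε * γ)) * φ ((1 - ε * γ) • m')) Gm m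
          ∧ φ' (m - ε • (α • f' x + γ • m))
              = Gm - (φ' ((1 - ε * γ) • m) - φ' (m - ε • (α • f' x + γ • m)))
          ∧ -(α • f' x) - γ • m = -Gx - γ • m)
    ∧ (∀ x m : ℝ → EuclideanSpace ℝ (Fin d),
        (∀ t, HasDerivAt x (φ' (m t - ε • (α • f' (x t) + γ • m t))) t) →
        (∀ t, HasDerivAt m (-(α • f' (x t)) - γ • m t) t) →
        ∀ t : ℝ,
          HasDerivAt
            (fun τ => α * f (x τ) + (1 / (1 - ε * γ)) * φ ((1 - ε * γ) • m τ))
            (-(γ * ⟪φ' ((1 - ε * γ) • m t), m t⟫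
              + (1 / ε) *
                  ⟪(1 - ε * γ) • m t - (m t - ε • (α • f' (x t) + γ • m t)),
                    φ' ((1 - ε * γ) • m t)
                      - φ' (m t - ε • (α • f' (x t) + γ • m t))⟫)) t
          ∧ 0 ≤ γ * ⟪φ' ((1 - ε * γ) • m t), m t⟫
              + (1 / ε) *
                  ⟪(1 - ε * γ) • m t - (m t - ε • (α • f' (x t) + γ • m t)),
                    φ' ((1 - ε * γ) • m t)
                      - φ' (m t - ε • (α • f' (x t) + γ • m t))⟫) := by
  have hc : 0 < 1 - ε * γ := by linarith
  refine ⟨fun x m => ⟨α • f' x, φ' ((1 - ε * γ) • m), ?_, ?_, ?_, rfl⟩, ?_⟩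
  · rw [hasGradientAt_iff_hasFDerivAt, map_smul]
    exact ((hf' x).hasFDerivAt.const_mul α).add_const _
  · rw [hasGradientAt_iff_hasFDerivAt]
    have hs : HasFDerivAt (fun m' : EuclideanSpace ℝ (Fin d) => (1 - ε * γ) • m')
        ((1 - ε * γ) • ContinuousLinearMap.id ℝ _) m :=
      (hasFDerivAt_id m).fun_const_smul (1 - ε * γ)
    refine ((((hφ' ((1 - ε * γ) • m)).hasFDerivAt.comp m hs).const_mul
      (1 / (1 - ε * γ))).const_add (α * f x)).congr_fderiv ?_
    ext v
    simp [hc.ne']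
  · abel
  · intro x m hx hm t
    have hdiff : (1 - ε * γ) • m t - (m t - ε • (α • f' (x t) + γ • m t))
        = (ε * α) • f' (x t) := by module
    constructor
    · refine ((((hf' (x t)).comp_hasDerivAt_curve (hx t)).const_mul α).add
        (((hφ' ((1 - ε * γ) • m t)).comp_hasDerivAt_curve
          ((hm t).const_smul (1 - ε * γ))).const_mul (1 / (1 - ε * γ)))).congr_deriv ?_
      rw [hdiff]
      simp only [inner_sub_right, inner_neg_right, real_inner_smul_right, real_inner_smul_left]
      rw [real_inner_comm (f' (x t)) (φ' ((1 - ε * γ) • m t))]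
      field_simp
      ring
    · have h := hconv.inner_gradient_self_nonneg (hφ' ((1 - ε * γ) • m t)) (hmin _)
      rw [real_inner_smul_right] at h
      have hm₀ := nonneg_of_mul_nonneg_right h hc
      have hmono := hconv.inner_sub_gradient_nonneg (hφ' ((1 - ε * γ) • m t))
        (hφ' (m t - ε • (α • f' (x t) + γ • m t)))
      positivity
end

section
/- Let φ : ℝ^d → ℝ be closed convex with conjugate φ*, let ∂φ denote a subgradient of φ, and consider the discrete Lion-φ iteration with implicit weight decay: m_{t+1} = β₂ m_t − (1−β₂) ∇f(x_t), m̃_{t+1} = β₁ m_t − (1−β₁) ∇f(x_t), x_{t+1} = x_t + ε ( ∂φ(m̃_{t+1}) − λ x_{t+1} ), with β₁, β₂ ∈ (0,1), β₂ > β₁, ε, λ > 0. Let dist(y, dom φ*) = inf_{z ∈ dom φ*} ‖z − y‖ with respect to any norm. Then for all nonnegative integers s ≤ t, dist(λ x_t, dom φ*) ≤ (1/(1+ελ))^{t−s} · dist(λ x_s, dom φ*). -/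
open scoped RealInnerProductSpace

/-- The effective domain of the conjugate, `dom φ* = {y : φ*(y) < +∞}`. -/
def fenchelDom {d : ℕ} (φ : EuclideanSpace ℝ (Fin d) → ℝ) :
    Set (EuclideanSpace ℝ (Fin d)) :=
  {y | fenchelConj φ y ≠ ⊤}

/-- The distance to a convex set contracts along the segment to a point of the set. -/
theorem Convex.infDist_smul_add_smul_le {E : Type*} [SeminormedAddCommGroup E]
    [NormedSpace ℝ E] {S : Set E} (hS : Convex ℝ S) {p : E} (hp : p ∈ S) (y : E)
    {a b : ℝ} (ha : 0 ≤ a) (hb : 0 ≤ b) (hab : a + b = 1) :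
    Metric.infDist (a • y + b • p) S ≤ a * Metric.infDist y S := by
  have key : ∀ q ∈ S, Metric.infDist (a • y + b • p) S ≤ a * dist y q := fun q hq =>
    (Metric.infDist_le_dist_of_mem (hS hq hp ha hb hab)).trans_eq <| by
      rw [dist_add_right, dist_smul₀, Real.norm_of_nonneg ha]
  refine le_of_forall_pos_le_add fun δ hδ => ?_
  obtain ⟨q, hq, hqy⟩ :=
    (Metric.infDist_lt_iff ⟨p, hp⟩).1 (lt_add_of_pos_right (Metric.infDist y S) hδ)
  nlinarith [key q hq]

theorem mem_fenchelDom_iff {d : ℕ} {φ : EuclideanSpace ℝ (Fin d) → ℝ}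
    {y : EuclideanSpace ℝ (Fin d)} :
    y ∈ fenchelDom φ ↔ ∃ C : ℝ, ∀ z, ⟪y, z⟫ - φ z ≤ C := by
  constructor
  · intro hy
    obtain ⟨C, hC, -⟩ := EReal.lt_iff_exists_real_btwn.1 (lt_top_iff_ne_top.2 hy)
    exact ⟨C, fun z => EReal.coe_le_coe_iff.1 <|
      (le_iSup (fun z => ((⟪y, z⟫ - φ z : ℝ) : EReal)) z).trans hC.le⟩
  · rintro ⟨C, hC⟩
    exact ((iSup_le fun z => EReal.coe_le_coe_iff.2 (hC z)).trans_lt (EReal.coe_lt_top C)).ne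

theorem convex_fenchelDom {d : ℕ} (φ : EuclideanSpace ℝ (Fin d) → ℝ) :
    Convex ℝ (fenchelDom φ) := by
  intro y hy w hw a b ha hb hab
  obtain ⟨C, hC⟩ := mem_fenchelDom_iff.1 hy
  obtain ⟨D, hD⟩ := mem_fenchelDom_iff.1 hw
  refine mem_fenchelDom_iff.2 ⟨a * C + b * D, fun z => ?_⟩
  calc ⟪a • y + b • w, z⟫ - φ z = a * (⟪y, z⟫ - φ z) + b * (⟪w, z⟫ - φ z) := by
        rw [inner_add_left, real_inner_smul_left, real_inner_smul_left]
        linear_combination φ z * hab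
    _ ≤ a * C + b * D := by gcongr <;> apply_assumption

theorem mem_fenchelDom_of_subgradient {d : ℕ} {φ : EuclideanSpace ℝ (Fin d) → ℝ}
    {g z : EuclideanSpace ℝ (Fin d)} (hg : ∀ w, ⟪g, w - z⟫ ≤ φ w - φ z) :
    g ∈ fenchelDom φ := by
  refine mem_fenchelDom_iff.2 ⟨⟪g, z⟫ - φ z, fun w => ?_⟩
  have h := hg w
  rw [inner_sub_right] at h
  linarith

/-- Phase 1, discrete time: for the discrete Lion-φ iteration
`m_{t+1} = β₂m_t − (1−β₂)∇f(x_t)`, `m̃_{t+1} = β₁m_t − (1−β₁)∇f(x_t)`,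
`x_{t+1} = x_t + ε(∂φ(m̃_{t+1}) − λx_{t+1})` with `β₁, β₂ ∈ (0,1)`, `β₂ > β₁`,
`ε, λ > 0`, the distance of `λ x_t` to `dom φ*` contracts:
`dist(λx_t, dom φ*) ≤ (1/(1+ελ))^{t−s} dist(λx_s, dom φ*)` for all `s ≤ t`. -/
theorem lion_phase_one_discrete {d : ℕ}
    (φ f : EuclideanSpace ℝ (Fin d) → ℝ)
    (f' sg : EuclideanSpace ℝ (Fin d) → EuclideanSpace ℝ (Fin d))
    (hconv : ConvexOn ℝ Set.univ φ) (hclosed : LowerSemicontinuous φ)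
    (hf' : ∀ z, HasGradientAt f (f' z) z)
    (hsg : ∀ z w, ⟪sg z, w - z⟫ ≤ φ w - φ z)
    (β₁ β₂ ε lam : ℝ)
    (hβ₁ : β₁ ∈ Set.Ioo (0 : ℝ) 1) (hβ₂ : β₂ ∈ Set.Ioo (0 : ℝ) 1)
    (hββ : β₁ < β₂) (hε : 0 < ε) (hlam : 0 < lam)
    (x m mt : ℕ → EuclideanSpace ℝ (Fin d))
    (hm : ∀ t, m (t + 1) = β₂ • m t - (1 - β₂) • f' (x t))
    (hmt : ∀ t, mt (t + 1) = β₁ • m t - (1 - β₁) • f' (x t))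
    (hx : ∀ t, x (t + 1) = x t + ε • (sg (mt (t + 1)) - lam • x (t + 1))) :
    ∀ s t : ℕ, s ≤ t →
      Metric.infDist (lam • x t) (fenchelDom φ)
        ≤ (1 / (1 + ε * lam)) ^ (t - s) *
            Metric.infDist (lam • x s) (fenchelDom φ) := by
  have hpos : 0 < 1 + ε * lam := by positivity
  have step : ∀ t, Metric.infDist (lam • x (t + 1)) (fenchelDom φ) ≤
      1 / (1 + ε * lam) * Metric.infDist (lam • x t) (fenchelDom φ) := fun t => by
    have hexpl : (1 + ε * lam) • x (t + 1) = x t + ε • sg (mt (t + 1)) := by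
      have h := hx t
      rw [smul_sub, add_sub, eq_sub_iff_add_eq] at h
      rw [← h, add_smul, one_smul, smul_smul]
    have hcomb : lam • x (t + 1) =
        (1 / (1 + ε * lam)) • (lam • x t) + (ε * lam / (1 + ε * lam)) • sg (mt (t + 1)) := by
      rw [← inv_smul_smul₀ hpos.ne' (x (t + 1)), hexpl]
      module
    rw [hcomb]
    exact (convex_fenchelDom φ).infDist_smul_add_smul_le
      (mem_fenchelDom_of_subgradient (hsg _)) _ (by positivity) (by positivity) (by field_simp)
  intro s t hst
  induction t, hst using Nat.le_induction with
  | base => simp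
  | succ t hst ih =>
    rw [Nat.succ_sub hst, pow_succ', mul_assoc]
    exact (step t).trans (mul_le_mul_of_nonneg_left ih (by positivity))
end
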